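/- arXiv:1810.09170 — 6 statements merged into one kernel-verified Lean document; each statement's English description precedes it below -/
import Mathlib

section
/- Let n ≥ 1 and let a = (a_1,…,a_n) and b = (b_1,…,b_n) be integer sequences with a_1 ≤ a_2 ≤ ⋯ ≤ a_n, b_1 ≤ b_2 ≤ ⋯ ≤ b_n, and a_i ≥ b_i for all i. Then the number of weakly increasing integer sequences (y_1,…,y_n) satisfying b_i ≤ y_i ≤ a_i for all i = 1,…,n equals the determinant of the n×n matrix whose (i,j) entry is the binomial coefficient C(a_i − b_j + 1, j − i + 1). -/
/-- The binomial coefficient with the convention `C(x, t) = 0` whenever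
`t < 0` or `t > x`. -/
def hBinom (x t : ℤ) : ℤ := if 0 ≤ t ∧ t ≤ x then (x.toNat.choose t.toNat : ℤ) else 0

theorem hBinom_natCast (x : ℤ) (t : ℕ) :
    hBinom x t = if 0 ≤ x then (x.toNat.choose t : ℤ) else 0 := by
  unfold hBinom
  by_cases hx : 0 ≤ x
  · by_cases ht : (t : ℤ) ≤ x
    · simp [hx, ht]
    · have : x.toNat < t := by omega
      simp [hx, ht, Nat.choose_eq_zero_of_lt this]
  · have : ¬ (t : ℤ) ≤ x := by omega
    simp [hx, this]

theorem hBinom_of_neg_right (x : ℤ) {t : ℤ} (ht : t < 0) : hBinom x t = 0 := by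
  simp [hBinom, ht]

theorem hBinom_zero_right {x : ℤ} (hx : 0 ≤ x) : hBinom x 0 = 1 := by
  simp [hBinom, hx]

theorem hBinom_succ_succ (x : ℤ) (t : ℕ) :
    hBinom (x + 1) ((t + 1 : ℕ) : ℤ) = hBinom x t + hBinom x ((t + 1 : ℕ) : ℤ) := by
  simp only [hBinom_natCast]
  rcases lt_trichotomy x (-1) with hx | rfl | hx
  · rw [if_neg (by omega), if_neg (by omega), if_neg (by omega), add_zero]
  · simp
  · have h : (x + 1).toNat = x.toNat + 1 := by omega
    rw [if_pos (by omega), if_pos (by omega), if_pos (by omega), h, Nat.choose_succ_succ']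
    push_cast
    rfl

/-- The hockey-stick identity for `hBinom`. -/
theorem sum_Icc_hBinom_sub (x c s : ℤ) (hxc : x ≤ c) (t : ℕ) :
    ∑ u ∈ Finset.Icc (s + 1) c, hBinom (x - u) t = hBinom (x - s) ((t + 1 : ℕ) : ℤ) := by
  obtain ⟨d, hd⟩ : ∃ d : ℕ, (c - s).toNat = d := ⟨_, rfl⟩
  induction d generalizing s with
  | zero =>
    rw [Finset.Icc_eq_empty (by omega), Finset.sum_empty, hBinom_natCast]
    split_ifs with h
    · have : (x - s).toNat = 0 := by omega
      simp [this]
    · rfl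
  | succ d ih =>
    have hsplit : Finset.Icc (s + 1) c = insert (s + 1) (Finset.Icc (s + 1 + 1) c) := by
      ext u
      simp only [Finset.mem_Icc, Finset.mem_insert]
      omega
    rw [hsplit, Finset.sum_insert (by simp), ih (s + 1) (by omega), ← hBinom_succ_succ]
    congr 1
    ring

/-- The number of weakly increasing sequences `(y_0, …, y_{k-1})` with `b_i ≤ y_i ≤ a_i`
and all entries at most `s`, computed by summing over the last entry. -/
noncomputable def boundedSeqCount (a b : ℕ → ℤ) : ℕ → ℤ → ℤ
  | 0, _ => 1
  | k + 1, s => ∑ u ∈ Finset.Icc (b k) (min s (a k)), boundedSeqCount a b k u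

/-- The weakly increasing sequences of length `k` with `b_i ≤ y_i ≤ a_i` and `y_i ≤ s`. -/
abbrev BoundedSeq (a b : ℕ → ℤ) (k : ℕ) (s : ℤ) : Type :=
  {y : Fin k → ℤ // Monotone y ∧ ∀ i : Fin k, b i ≤ y i ∧ y i ≤ a i ∧ y i ≤ s}

theorem monotone_snoc_iff {k : ℕ} (y : Fin k → ℤ) (u : ℤ) :
    Monotone (Fin.snoc y u : Fin (k + 1) → ℤ) ↔ Monotone y ∧ ∀ i, y i ≤ u := by
  constructor
  · intro h
    refine ⟨fun i j hij => ?_, fun i => ?_⟩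
    · simpa using h (Fin.castSucc_le_castSucc_iff.2 hij)
    · simpa using h (Fin.le_last i.castSucc)
  · rintro ⟨hy, hu⟩ i j
    refine Fin.lastCases (fun hij => ?_) (fun j hij => ?_) j
    · refine Fin.lastCases ?_ (fun i => ?_) i
      · exact le_rfl
      · simpa using hu i
    · revert hij
      refine Fin.lastCases (fun hij => ?_) (fun i hij => ?_) i
      · exact absurd hij (not_le.2 (Fin.castSucc_lt_last j))
      · simpa using hy (Fin.castSucc_le_castSucc_iff.1 hij)

instance BoundedSeq.finite (a b : ℕ → ℤ) (k : ℕ) (s : ℤ) : Finite (BoundedSeq a b k s) := by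
  refine ((Set.finite_Icc (fun i : Fin k => b i) (fun i : Fin k => a i)).subset ?_).to_subtype
  exact fun y hy => ⟨fun i => (hy.2 i).1, fun i => (hy.2 i).2.1⟩

theorem BoundedSeq.sigma_ext {a b : ℕ → ℤ} {k : ℕ} {S : Finset ℤ}
    {p q : Σ u : S, BoundedSeq a b k u} (h₁ : p.1 = q.1) (h₂ : p.2.1 = q.2.1) : p = q := by
  obtain ⟨u, y⟩ := p
  obtain ⟨u', z⟩ := q
  obtain rfl : u = u' := h₁
  obtain rfl : y = z := Subtype.ext h₂
  rfl

/-- Splitting off the last entry of a bounded sequence. -/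
def BoundedSeq.succEquiv (a b : ℕ → ℤ) (k : ℕ) (s : ℤ) :
    BoundedSeq a b (k + 1) s ≃
      Σ u : Finset.Icc (b k) (min s (a k)), BoundedSeq a b k u where
  toFun y := ⟨⟨y.1 (Fin.last k), by
      have := y.2.2 (Fin.last k)
      simp only [Fin.val_last] at this
      simp only [Finset.mem_Icc, le_min_iff]
      tauto⟩, fun i => y.1 i.castSucc, fun i j hij => y.2.1 (Fin.castSucc_le_castSucc_iff.2 hij),
        fun i => ⟨(y.2.2 i.castSucc).1, (y.2.2 i.castSucc).2.1, y.2.1 (Fin.le_last _)⟩⟩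
  invFun p := ⟨Fin.snoc p.2.1 p.1.1, (monotone_snoc_iff _ _).2 ⟨p.2.2.1, fun i => (p.2.2.2 i).2.2⟩,
    fun i => by
      have hu := Finset.mem_Icc.1 p.1.2
      rw [le_min_iff] at hu
      refine Fin.lastCases ?_ (fun i => ?_) i
      · simp only [Fin.snoc_last, Fin.val_last]
        tauto
      · have := p.2.2.2 i
        simp only [Fin.snoc_castSucc, Fin.val_castSucc]
        exact ⟨this.1, this.2.1, this.2.2.trans hu.2.1⟩⟩
  left_inv y := by
    apply Subtype.ext
    exact Fin.snoc_init_self y.1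
  right_inv p := by
    apply BoundedSeq.sigma_ext
    · exact Subtype.ext (Fin.snoc_last (α := fun _ => ℤ) _ _)
    · exact Fin.init_snoc (α := fun _ => ℤ) _ _

theorem card_boundedSeq (a b : ℕ → ℤ) (k : ℕ) (s : ℤ) :
    (Nat.card (BoundedSeq a b k s) : ℤ) = boundedSeqCount a b k s := by
  induction k generalizing s with
  | zero =>
    have : Unique (BoundedSeq a b 0 s) :=
      { default := ⟨Fin.elim0, fun i => i.elim0, fun i => i.elim0⟩
        uniq := fun y => Subtype.ext (Subsingleton.elim _ _) }
    simp [boundedSeqCount]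
  | succ k ih =>
    rw [Nat.card_congr (BoundedSeq.succEquiv a b k s), Nat.card_sigma, boundedSeqCount]
    push_cast
    simp only [ih]
    exact Finset.sum_coe_sort _ (fun u => boundedSeqCount a b k u)

theorem boundedSeqCount_eq_sum {a b : ℕ → ℤ} (ha : Monotone a) (hb : Monotone b) (k : ℕ) (s : ℤ)
    (hbs : ∀ j, j + 1 = k → b j - 1 ≤ s) (hsa : s ≤ a k) :
    boundedSeqCount a b k s = ∑ i ∈ Finset.range (k + 1),
      (-1) ^ (k - i) * boundedSeqCount a b i (a i) * hBinom (a i - s) ((k - i : ℕ) : ℤ) := by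
  induction k generalizing s with
  | zero => simp [boundedSeqCount, hBinom_zero_right (sub_nonneg.2 hsa)]
  | succ k ih =>
    have hs := hbs k rfl
    have hsplit : boundedSeqCount a b (k + 1) (a (k + 1)) = boundedSeqCount a b (k + 1) s +
        ∑ u ∈ Finset.Icc (s + 1) (a k), boundedSeqCount a b k u := by
      have hak : a k ≤ a (k + 1) := ha k.le_succ
      rw [boundedSeqCount, boundedSeqCount, min_eq_right hak, ← Finset.sum_union]
      · congr 1
        ext u
        simp only [Finset.mem_union, Finset.mem_Icc, le_min_iff]
        omega
      · rw [Finset.disjoint_left]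
        intro u
        simp only [Finset.mem_Icc, le_min_iff]
        omega
    have htail : ∑ u ∈ Finset.Icc (s + 1) (a k), boundedSeqCount a b k u =
        ∑ i ∈ Finset.range (k + 1), (-1) ^ (k - i) * boundedSeqCount a b i (a i) *
          hBinom (a i - s) ((k + 1 - i : ℕ) : ℤ) := by
      rw [Finset.sum_congr rfl fun u hu => ih u (fun j hj => ?_) (Finset.mem_Icc.1 hu).2,
        Finset.sum_comm]
      · refine Finset.sum_congr rfl fun i hi => ?_
        have hik : i ≤ k := Nat.lt_succ_iff.1 (Finset.mem_range.1 hi)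
        rw [← Finset.mul_sum, sum_Icc_hBinom_sub _ _ _ (ha hik), Nat.succ_sub hik]
      · have h1 := (Finset.mem_Icc.1 hu).1
        have h2 : b j ≤ b k := hb (by omega)
        omega
    have hneg : ∑ i ∈ Finset.range (k + 1), (-1) ^ (k + 1 - i) * boundedSeqCount a b i (a i) *
          hBinom (a i - s) ((k + 1 - i : ℕ) : ℤ) =
        -∑ u ∈ Finset.Icc (s + 1) (a k), boundedSeqCount a b k u := by
      rw [htail, ← Finset.sum_neg_distrib]
      refine Finset.sum_congr rfl fun i hi => ?_
      have hik : i ≤ k := Nat.lt_succ_iff.1 (Finset.mem_range.1 hi)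
      rw [Nat.succ_sub hik, pow_succ]
      ring
    rw [Finset.sum_range_succ, hneg, Nat.sub_self, pow_zero, one_mul, Nat.cast_zero,
      hBinom_zero_right (sub_nonneg.2 hsa), mul_one, hsplit]
    ring

theorem sum_boundedSeqCount_mul_hBinom {a b : ℕ → ℤ} (ha : Monotone a) (hb : Monotone b)
    (hab : ∀ i, b i ≤ a i) (k : ℕ) :
    ∑ i ∈ Finset.range (k + 2), (-1) ^ i * boundedSeqCount a b i (a i) *
      hBinom (a i - b k + 1) ((k : ℤ) - i + 1) = 0 := by
  have hk : b k - 1 ≤ a (k + 1) := by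
    have := ha k.le_succ
    have := hab k
    simp only [Nat.succ_eq_add_one] at *
    omega
  have h := boundedSeqCount_eq_sum ha hb (k + 1) (b k - 1)
    (fun j hj => by rw [Nat.succ_injective hj]) hk
  have h0 : boundedSeqCount a b (k + 1) (b k - 1) = 0 := by
    rw [boundedSeqCount, Finset.Icc_eq_empty, Finset.sum_empty]
    rw [le_min_iff]
    omega
  rw [h0] at h
  rw [← mul_zero ((-1 : ℤ) ^ (k + 1)), h, Finset.mul_sum]
  refine Finset.sum_congr rfl fun i hi => ?_
  have hik : i ≤ k + 1 := Nat.lt_succ_iff.1 (Finset.mem_range.1 hi)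
  have hsign : (-1 : ℤ) ^ (k + 1) * (-1) ^ (k + 1 - i) = (-1) ^ i := by
    obtain ⟨d, hd⟩ := Nat.exists_eq_add_of_le hik
    rw [hd, Nat.add_sub_cancel_left, pow_add, mul_assoc, ← mul_pow]
    simp
  rw [← mul_assoc, ← mul_assoc, hsign, Nat.cast_sub hik]
  congr 2
  · ring
  · push_cast
    ring

/-- If some combination of the rows of an upper Hessenberg matrix with unit subdiagonal, with
coefficient `1` at the first row, is supported in the last column, then the determinant is,
up to sign, the entry of that combination there. -/
theorem Matrix.det_of_hessenberg {R : Type*} [CommRing R] {m : ℕ}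
    (M : Matrix (Fin (m + 1)) (Fin (m + 1)) R)
    (hzero : ∀ i j : Fin (m + 1), (j : ℕ) + 1 < i → M i j = 0)
    (hone : ∀ i : Fin m, M i.succ i.castSucc = 1)
    (v : Fin (m + 1) → R) (hv : v 0 = 1)
    (hvM : ∀ j : Fin m, ∑ i, v i * M i j.castSucc = 0) :
    M.det = (-1) ^ m * ∑ i, v i * M i (Fin.last m) := by
  have hminor : (M.submatrix Fin.succ Fin.castSucc).det = 1 := by
    rw [Matrix.det_of_isUpperTriangular]
    · simp [hone]
    · intro i j hij
      apply hzero
      simpa using hij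
  have h := Matrix.det_updateRow_sum M 0 v
  rw [hv, one_smul] at h
  rw [← h, Matrix.det_succ_row_zero, Fin.sum_univ_castSucc, Finset.sum_eq_zero]
  · have hsub : (M.updateRow 0 (∑ k, v k • M k)).submatrix Fin.succ (Fin.last m).succAbove =
        M.submatrix Fin.succ Fin.castSucc := by
      ext i j
      simp
    rw [hsub, hminor]
    simp [Finset.sum_apply]
  · intro j _
    simp [Finset.sum_apply, hvM j]

/-- Lindström–Gessel–Viennot-type path counting (Theorem 10.7.1 of Krattenthaler):
the number of weakly increasing integer sequences `(y_1, …, y_n)` with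
`b_i ≤ y_i ≤ a_i` equals `det (C(a_i - b_j + 1, j - i + 1))`. -/
theorem path_count_det (n : ℕ) (hn : 1 ≤ n) (a b : Fin n → ℤ)
    (ha : Monotone a) (hb : Monotone b) (hab : ∀ i, b i ≤ a i) :
    (Nat.card {y : Fin n → ℤ // Monotone y ∧ ∀ i, b i ≤ y i ∧ y i ≤ a i} : ℤ) =
      (Matrix.of fun i j : Fin n =>
        hBinom (a i - b j + 1) (((j : ℕ) : ℤ) - ((i : ℕ) : ℤ) + 1)).det := by
  obtain ⟨m, rfl⟩ : ∃ m, n = m + 1 := ⟨n - 1, by omega⟩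
  let e : ℕ → Fin (m + 1) := fun i => ⟨min i m, by omega⟩
  have he : Monotone e := fun i j hij => Fin.mk_le_mk.2 (min_le_min_right m hij)
  have hei : ∀ i : Fin (m + 1), e i = i := fun i => Fin.ext (min_eq_left (by omega))
  obtain ⟨a', ha'⟩ : ∃ a' : ℕ → ℤ, a' = a ∘ e := ⟨_, rfl⟩
  obtain ⟨b', hb'⟩ : ∃ b' : ℕ → ℤ, b' = b ∘ e := ⟨_, rfl⟩
  have hma : Monotone a' := ha' ▸ ha.comp he
  have hmb : Monotone b' := hb' ▸ hb.comp he
  have hab' : ∀ i, b' i ≤ a' i := fun i => by simpa [ha', hb'] using hab (e i)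
  have hai : ∀ i : Fin (m + 1), a i = a' i := fun i => by simp [ha', hei]
  have hbi : ∀ i : Fin (m + 1), b i = b' i := fun i => by simp [hb', hei]
  have hcard : (Nat.card {y : Fin (m + 1) → ℤ // Monotone y ∧ ∀ i, b i ≤ y i ∧ y i ≤ a i} : ℤ) =
      boundedSeqCount a' b' (m + 1) (a' (m + 1)) := by
    rw [← card_boundedSeq]
    congr 1
    refine Nat.card_congr (Equiv.subtypeEquivRight fun y => and_congr_right fun _ =>
      forall_congr' fun i => ?_)
    have : a' i ≤ a' (m + 1) := hma i.is_lt.le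
    rw [hai, hbi]
    constructor
    · exact fun h => ⟨h.1, h.2, h.2.trans this⟩
    · exact fun h => ⟨h.1, h.2.1⟩
  simp only [hai, hbi]
  simp only [hai, hbi] at hcard
  rw [hcard, Matrix.det_of_hessenberg _ _ _
    (fun i => (-1) ^ (i : ℕ) * boundedSeqCount a' b' i (a' i))]
  · have h := sum_boundedSeqCount_mul_hBinom hma hmb hab' m
    have h0 : 0 ≤ a' (m + 1) - b' m + 1 := by
      have := hma m.le_succ
      have := hab' m
      simp only [Nat.succ_eq_add_one] at *
      omega
    have hz : (m : ℤ) - ((m + 1 : ℕ) : ℤ) + 1 = 0 := by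
      push_cast
      ring
    rw [Finset.sum_range_succ, hz, hBinom_zero_right h0, mul_one] at h
    simp only [Matrix.of_apply, Fin.val_last]
    rw [Fin.sum_univ_eq_sum_range (fun i => (-1) ^ i * boundedSeqCount a' b' i (a' i) *
      hBinom (a' i - b' m + 1) ((m : ℤ) - i + 1)), eq_neg_of_add_eq_zero_left h, pow_succ]
    have hsq : (-1 : ℤ) ^ m * (-1) ^ m = 1 := by
      rw [← mul_pow]
      simp
    linear_combination (-boundedSeqCount a' b' (m + 1) (a' (m + 1))) * hsq
  · simp [boundedSeqCount]
  · intro j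
    have h := sum_boundedSeqCount_mul_hBinom hma hmb hab' j
    simp only [Matrix.of_apply, Fin.val_castSucc]
    rw [Fin.sum_univ_eq_sum_range (fun i => (-1) ^ i * boundedSeqCount a' b' i (a' i) *
      hBinom (a' i - b' j + 1) ((j : ℤ) - i + 1)), ← h]
    symm
    refine Finset.sum_subset (Finset.range_subset_range.2 (by omega)) fun i _ hi => ?_
    rw [Finset.mem_range] at hi
    rw [hBinom_of_neg_right _ (by omega), mul_zero]
  · intro i j hij
    exact hBinom_of_neg_right _ (by omega)
  · intro i
    have h1 : a' i ≤ a' (i + 1) := hma (Nat.le_succ _)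
    have h2 := hab' i
    have hz : ((i : ℕ) : ℤ) - ((i + 1 : ℕ) : ℤ) + 1 = 0 := by
      push_cast
      ring
    simp only [Matrix.of_apply, Fin.val_castSucc, Fin.val_succ, hz]
    exact hBinom_zero_right (by omega)
end

section
/- Let k and n be positive integers and set a_i = k(i−1) for i = 1,…,n. Then the determinant of the n×n matrix whose (i,j) entry is the binomial coefficient C(a_i + 1, j − i + 1) equals the k-Fuss–Catalan number F_n = (1/(kn+1))·C((k+1)n, n). -/
lemma hBinom_natCast_s1 (a t : ℕ) : hBinom a t = a.choose t := by
  unfold hBinom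
  split_ifs with h
  · simp
  · rw [Nat.choose_eq_zero_of_lt (by omega), Nat.cast_zero]

lemma hBinom_of_neg {x t : ℤ} (h : t < 0) : hBinom x t = 0 :=
  if_neg (by omega)

/-- The Fuss–Catalan number `C((k+1) n, n) / (k n + 1)`, as a rational number. -/
def fussCatalan (k n : ℕ) : ℚ := ((k + 1) * n).choose n / ((k * n : ℕ) + 1)

lemma choose_div_mul_choose_mul_factorial (a i t : ℕ) (hit : 0 < i + t) :
    ((i + a).choose i : ℚ) / (a + 1) * (a + 1).choose t * (i + t).factorial =
      (i + t).choose i * (i + a).descFactorial (i + t - 1) := by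
  rcases lt_or_ge (a + 1) t with h | h
  · rw [Nat.choose_eq_zero_of_lt h, Nat.descFactorial_of_lt (by omega)]
    simp
  · obtain ⟨r, hr⟩ := Nat.exists_eq_add_of_le h
    have hfac (x y : ℕ) : (x + y).choose x * x.factorial * y.factorial = (x + y).factorial := by
      simpa using Nat.choose_mul_factorial_mul_factorial (Nat.le_add_right x y)
    have h₁ : ((i + a).choose i * i.factorial * a.factorial : ℚ) = (i + a).factorial :=
      mod_cast hfac i a
    have h₂ : ((a + 1).choose t * t.factorial * r.factorial : ℚ) =
        (a + 1) * a.factorial := by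
      rw [hr]
      exact_mod_cast (hfac t r).trans
        (by rw [← hr, Nat.factorial_succ])
    have h₃ : ((i + t).choose i * i.factorial * t.factorial : ℚ) = (i + t).factorial :=
      mod_cast hfac i t
    have h₄ : (r.factorial * (i + a).descFactorial (i + t - 1) : ℚ) = (i + a).factorial := by
      have := Nat.factorial_mul_descFactorial (n := i + a) (k := i + t - 1) (by omega)
      rw [show i + a - (i + t - 1) = r by omega] at this
      exact_mod_cast this
    have ha : (a.factorial : ℚ) ≠ 0 := mod_cast a.factorial_ne_zero
    have hr0 : (r.factorial : ℚ) ≠ 0 := mod_cast r.factorial_ne_zero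
    have ha1 : (a + 1 : ℚ) ≠ 0 := by positivity
    rw [← h₃, div_mul_eq_mul_div, div_mul_eq_mul_div, div_eq_iff ha1]
    refine mul_right_cancel₀ hr0 (mul_right_cancel₀ ha ?_)
    linear_combination ((i + t).choose i * i.factorial * a.factorial * (i + a).choose i : ℚ) * h₂
      + ((i + t).choose i * (a + 1) * a.factorial : ℚ) * h₁
      - ((i + t).choose i * (a + 1) * a.factorial : ℚ) * h₄

lemma sum_neg_one_pow_mul_choose_mul_eval_eq_zero {R : Type*} [CommRing R] {n : ℕ}
    {P : Polynomial R} (hP : P.natDegree < n) :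
    ∑ i ∈ Finset.range (n + 1), (-1 : R) ^ i * (n.choose i * P.eval (i : R)) = 0 := by
  have h := congrFun (Polynomial.fwdDiff_iter_eq_zero_of_degree_lt hP) 0
  rw [fwdDiff_iter_eq_sum_shift] at h
  have h' := congrArg ((-1 : R) ^ n * ·) h
  simp only [Pi.zero_apply, mul_zero, Finset.mul_sum] at h'
  rw [← h']
  refine Finset.sum_congr rfl fun i hi => ?_
  obtain ⟨t, rfl⟩ := Nat.exists_eq_add_of_le (Nat.lt_succ_iff.mp (Finset.mem_range.mp hi))
  have : (-1 : R) ^ t * (-1) ^ t = 1 := by rw [← mul_pow]; simp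
  simp only [Nat.add_sub_cancel_left, zsmul_eq_mul, zero_add, nsmul_eq_mul, mul_one]
  push_cast
  rw [pow_add]
  linear_combination (-(-1 : R) ^ i * (i + t).choose i * P.eval (i : R)) * this

lemma sum_neg_one_pow_mul_fussCatalan_mul_choose (k : ℕ) {n : ℕ} (hn : 0 < n) :
    ∑ i ∈ Finset.range (n + 1),
      (-1 : ℚ) ^ i * fussCatalan k i * (k * i + 1).choose (n - i) = 0 := by
  have hdeg : ((descPochhammer ℚ (n - 1)).comp
      (Polynomial.C (k + 1 : ℚ) * Polynomial.X)).natDegree < n := by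
    refine Polynomial.natDegree_comp_le.trans_lt ?_
    rw [descPochhammer_natDegree]
    have := Polynomial.natDegree_C_mul_le (k + 1 : ℚ) Polynomial.X
    rw [Polynomial.natDegree_X] at this
    have := Nat.mul_le_mul_left (n - 1) this
    omega
  refine mul_right_cancel₀ (mod_cast n.factorial_ne_zero : (n.factorial : ℚ) ≠ 0) ?_
  rw [zero_mul, ← sum_neg_one_pow_mul_choose_mul_eval_eq_zero hdeg, Finset.sum_mul]
  refine Finset.sum_congr rfl fun i hi => ?_
  obtain ⟨t, rfl⟩ := Nat.exists_eq_add_of_le (Nat.lt_succ_iff.mp (Finset.mem_range.mp hi))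
  have heval : ((descPochhammer ℚ (i + t - 1)).comp
      (Polynomial.C (k + 1 : ℚ) * Polynomial.X)).eval (i : ℚ) =
      (i + k * i).descFactorial (i + t - 1) := by
    rw [← descPochhammer_eval_eq_descFactorial]
    simp only [Polynomial.eval_comp, Polynomial.eval_mul, Polynomial.eval_C, Polynomial.eval_X]
    congr 1
    push_cast
    ring
  rw [heval, ← choose_div_mul_choose_mul_factorial _ _ _ hn, fussCatalan,
    show (k + 1) * i = i + k * i by ring, Nat.add_sub_cancel_left]
  ring

/-- A matrix with unit subdiagonal and zeros below it whose rows combine, with leading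
coefficient `1`, to a multiple of the last basis vector. -/
lemma det_eq_of_vecMul_eq_single_last {R : Type*} [CommRing R] {m : ℕ}
    {M : Matrix (Fin (m + 1)) (Fin (m + 1)) R} {u : Fin (m + 1) → R} {d : R}
    (hsub : ∀ j : Fin m, M j.succ j.castSucc = 1)
    (hzero : ∀ i j : Fin m, j < i → M i.succ j.castSucc = 0)
    (hu : u 0 = 1) (hcomb : ∑ i, u i • M i = Pi.single (Fin.last m) d) :
    M.det = (-1) ^ m * d := by
  have h := M.det_updateRow_sum 0 u
  rw [hu, one_smul, hcomb, Matrix.det_succ_row_zero,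
    Finset.sum_eq_single (Fin.last m) (fun j _ hj => by simp [hj]) (by simp)] at h
  have htri : (M.submatrix Fin.succ (Fin.last m).succAbove).det = 1 := by
    rw [Matrix.det_of_isUpperTriangular]
    · simp [hsub]
    · intro i j hij
      simpa using hzero i j hij
  have hminor : (M.updateRow 0 (Pi.single (Fin.last m) d)).submatrix Fin.succ
      (Fin.last m).succAbove = M.submatrix Fin.succ (Fin.last m).succAbove := by
    ext i j
    simp [Matrix.updateRow_apply]
  rw [← h, hminor, htri]
  simp

/-- With `a_i = k (i - 1)` (so `a_i = k * i` for the 0-based index `i`), the determinant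
of the `n × n` matrix with entries `C(a_i + 1, j - i + 1)` equals the `k`-Fuss–Catalan
number `F_n = (1 / (k n + 1)) * C((k+1) n, n)`. -/
theorem det_eq_fussCatalan (k n : ℕ) (hk : 0 < k) (hn : 0 < n) :
    ((Matrix.of fun i j : Fin n =>
        ((hBinom ((k * (i : ℕ) : ℕ) + 1) (((j : ℕ) : ℤ) - ((i : ℕ) : ℤ) + 1) : ℤ) : ℚ)).det) =
      ((((k + 1) * n).choose n : ℚ)) / ((k * n : ℕ) + 1) := by
  obtain ⟨m, rfl⟩ := Nat.exists_eq_succ_of_ne_zero hn.ne'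
  have hentry (i j : ℕ) (hij : i ≤ j + 1) :
      hBinom ((k * i : ℕ) + 1) ((j : ℤ) - i + 1) = (k * i + 1).choose (j + 1 - i) := by
    rw [← hBinom_natCast_s1]
    push_cast [hij]
    congr 1
    ring
  have hlow (i j : ℕ) (hij : j + 1 < i) :
      hBinom ((k * i : ℕ) + 1) ((j : ℤ) - i + 1) = 0 := hBinom_of_neg (by omega)
  rw [det_eq_of_vecMul_eq_single_last (u := fun i => (-1) ^ (i : ℕ) * fussCatalan k i)
    (d := (-1) ^ m * fussCatalan k (m + 1)), ← mul_assoc, ← mul_pow]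
  · simp [fussCatalan]
  · intro j
    have := hentry (j + 1) j le_rfl
    simpa using this
  · intro i j hij
    have := hlow (i + 1) j (by simpa using hij)
    simpa using this
  · simp [fussCatalan]
  · ext j
    have hsum := sum_neg_one_pow_mul_fussCatalan_mul_choose k (Nat.succ_pos (j : ℕ))
    have hterm (i : ℕ) (hi : i ∈ Finset.range (j + 1 + 1)) :
        (-1 : ℚ) ^ i * fussCatalan k i * (k * i + 1).choose (j + 1 - i) =
        (-1 : ℚ) ^ i * fussCatalan k i * hBinom ((k * i : ℕ) + 1) ((j : ℕ) - (i : ℤ) + 1) := by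
      rw [hentry i j (by simpa [Nat.lt_succ_iff] using hi), Int.cast_natCast]
    rw [Nat.succ_eq_add_one, Finset.sum_congr rfl hterm] at hsum
    simp only [Finset.sum_apply, Pi.smul_apply, Matrix.of_apply, smul_eq_mul]
    rw [Fin.sum_univ_eq_sum_range (fun i : ℕ => (-1 : ℚ) ^ i * fussCatalan k i *
      hBinom ((k * i : ℕ) + 1) ((j : ℕ) - (i : ℤ) + 1))]
    rcases eq_or_ne j (Fin.last m) with rfl | hj
    · rw [Finset.sum_range_succ] at hsum
      simp only [Fin.val_last] at hsum ⊢
      rw [hentry (m + 1) m le_rfl] at hsum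
      simp only [Nat.sub_self, Nat.choose_zero_right, Nat.cast_one, Int.cast_one] at hsum
      rw [Pi.single_eq_same]
      linear_combination hsum
    · have hjm : (j : ℕ) < m := Fin.val_lt_last hj
      rw [Pi.single_eq_of_ne hj, ← hsum]
      symm
      refine Finset.sum_subset (Finset.range_mono (by omega)) fun i _ hi => ?_
      rw [hlow i j (by simp at hi; omega), Int.cast_zero, mul_zero]
end

section
/- Let k and n be positive integers. The number of weakly increasing sequences of natural numbers (y_1,…,y_n) with y_i ≤ k(i−1) for all i = 1,…,n equals the determinant of the n×n matrix whose (i,j) entry is C(k(i−1) + 1, j − i + 1). -/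
/-- The number of weakly increasing sequences `(y_0, …, y_{n-1})` of naturals with `y_i ≤ b i` and
all entries less than `c`, computed recursively on the last entry. -/
def boundedPathCount (b : ℕ → ℕ) : ℕ → ℕ → ℕ
  | 0, _ => 1
  | n + 1, c => ∑ v ∈ Finset.range (min c (b n + 1)), boundedPathCount b n (v + 1)

/-- The weakly increasing sequences counted by `boundedPathCount b n c`. -/
abbrev BoundedPath (b : ℕ → ℕ) (n c : ℕ) : Type :=
  {y : Fin n → ℕ // Monotone y ∧ (∀ i, y i ≤ b i) ∧ ∀ i, y i < c}

/-- Splitting a nonempty bounded path into its last entry and the path before it. -/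
def boundedPathEquiv (b : ℕ → ℕ) (n c : ℕ) :
    BoundedPath b (n + 1) c ≃ Σ v : Fin (min c (b n + 1)), BoundedPath b n (v + 1) where
  toFun y := ⟨⟨y.1 (Fin.last n), by
      have h₁ := y.2.2.1 (Fin.last n)
      have h₂ := y.2.2.2 (Fin.last n)
      simp only [Fin.val_last] at h₁
      omega⟩,
    ⟨fun i => y.1 i.castSucc, fun i j h => y.2.1 (Fin.castSucc_le_castSucc_iff.2 h),
      fun i => y.2.2.1 i.castSucc, fun i => Nat.lt_succ_of_le (y.2.1 (Fin.le_last _))⟩⟩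
  invFun p := ⟨Fin.snoc (α := fun _ => ℕ) p.2.1 p.1, by
    obtain ⟨⟨v, hv⟩, ⟨y, hmono, hb, hlt⟩⟩ := p
    refine ⟨fun i j h => ?_, fun i => ?_, fun i => ?_⟩
    · induction j using Fin.lastCases with
      | last =>
        induction i using Fin.lastCases with
        | last => simp
        | cast i => simpa using Nat.le_of_lt_succ (hlt i)
      | cast j =>
        induction i using Fin.lastCases with
        | last => exact absurd h (not_le.2 (Fin.castSucc_lt_last j))
        | cast i => simpa using hmono (Fin.castSucc_le_castSucc_iff.1 h)
    · induction i using Fin.lastCases with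
      | last => simp only [Fin.snoc_last, Fin.val_last]; omega
      | cast i => simpa using hb i
    · induction i using Fin.lastCases with
      | last => simp only [Fin.snoc_last]; omega
      | cast i =>
        have := hlt i
        simp only [Fin.snoc_castSucc] at this ⊢
        omega⟩
  left_inv y := by
    ext i
    induction i using Fin.lastCases <;> simp
  right_inv p := by
    obtain ⟨⟨v, hv⟩, ⟨y, hy⟩⟩ := p
    refine Sigma.ext (by simp) ?_
    simp only [Fin.snoc_castSucc]
    congr!
    simp

theorem finite_boundedPath (b : ℕ → ℕ) (n c : ℕ) : Finite (BoundedPath b n c) :=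
  Finite.of_injective (fun (y : BoundedPath b n c) i => (⟨y.1 i, y.2.2.2 i⟩ : Fin c))
    fun _ _ h => Subtype.ext (funext fun i => congrArg Fin.val (congrFun h i))

theorem card_boundedPath (b : ℕ → ℕ) (n c : ℕ) :
    Nat.card (BoundedPath b n c) = boundedPathCount b n c := by
  induction n generalizing c with
  | zero =>
    have : Unique (BoundedPath b 0 c) :=
      { default := ⟨Fin.elim0, fun i => i.elim0, fun i => i.elim0, fun i => i.elim0⟩
        uniq := fun y => Subtype.ext (Subsingleton.elim _ _) }
    simp [boundedPathCount]
  | succ n ih =>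
    have := fun v => finite_boundedPath b n v
    rw [Nat.card_congr (boundedPathEquiv b n c), Nat.card_sigma, boundedPathCount,
      Finset.sum_range]
    exact Finset.sum_congr rfl fun v _ => ih _

/-- Raising the bound on the entries beyond the bound on the last entry has no effect. -/
theorem boundedPathCount_succ_of_lt (b : ℕ → ℕ) {n c : ℕ} (h : b n < c) :
    boundedPathCount b (n + 1) c = boundedPathCount b (n + 1) (b n + 1) := by
  simp [boundedPathCount, min_eq_right (Nat.succ_le_of_lt h)]

theorem card_monotone_le (b : ℕ → ℕ) (hb : Monotone b) (n : ℕ) :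
    Nat.card {y : Fin n → ℕ // Monotone y ∧ ∀ i, y i ≤ b i} =
      boundedPathCount b n (b n + 1) := by
  rw [← card_boundedPath]
  refine Nat.card_congr (Equiv.subtypeEquivRight fun y =>
    ⟨fun h => ⟨h.1, h.2, fun i => ?_⟩, fun h => ⟨h.1, h.2.1⟩⟩)
  exact Nat.lt_succ_of_le ((h.2 i).trans (hb i.2.le))

/-- The number of sequences `y_0 ≤ ⋯ ≤ y_i > y_{i+1} > ⋯ > y_{i+t}` with `y_j ≤ b j` for
`j ≤ i`. -/
def unimodalCount (b : ℕ → ℕ) (i t : ℕ) : ℕ :=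
  ∑ v ∈ Finset.range (b i + 1), boundedPathCount b i (v + 1) * v.choose t

theorem unimodalCount_zero_right (b : ℕ → ℕ) (i : ℕ) :
    unimodalCount b i 0 = boundedPathCount b (i + 1) (b i + 1) := by
  simp [unimodalCount, boundedPathCount]

theorem boundedPathCount_zero_mul_choose (b : ℕ → ℕ) (s : ℕ) :
    boundedPathCount b 0 (b 0 + 1) * (b 0 + 1).choose (s + 1) = unimodalCount b 0 s := by
  simp only [boundedPathCount, unimodalCount, one_mul]
  induction b 0 + 1 with
  | zero => simp
  | succ c ih => rw [Finset.sum_range_succ, ← ih, Nat.choose_succ_succ, add_comm]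

theorem boundedPathCount_succ_mul_choose_eq_sum (b : ℕ → ℕ) (i s c : ℕ) :
    boundedPathCount b (i + 1) c * c.choose (s + 1) =
      ∑ v ∈ Finset.range c, boundedPathCount b (i + 1) (v + 1) * v.choose s +
        ∑ v ∈ Finset.range (min c (b i + 1)),
          boundedPathCount b i (v + 1) * v.choose (s + 1) := by
  induction c with
  | zero => simp
  | succ c ih =>
    rw [Finset.sum_range_succ, Nat.choose_succ_succ, mul_add]
    rcases Nat.lt_or_ge (b i) c with h | h
    · rw [boundedPathCount_succ_of_lt b h] at ih
      rw [boundedPathCount_succ_of_lt b (h.trans c.lt_succ_self), ih,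
        min_eq_right (by omega), min_eq_right (by omega)]
      ring
    · have hrec : boundedPathCount b (i + 1) (c + 1) =
          boundedPathCount b (i + 1) c + boundedPathCount b i (c + 1) := by
        simp only [boundedPathCount]
        rw [min_eq_left (by omega), min_eq_left (by omega), Finset.sum_range_succ]
      rw [min_eq_left (by omega)] at ih ⊢
      rw [Finset.sum_range_succ, hrec]
      linear_combination ih

theorem boundedPathCount_succ_mul_choose (b : ℕ → ℕ) (hb : Monotone b) (i s : ℕ) :
    boundedPathCount b (i + 1) (b (i + 1) + 1) * (b (i + 1) + 1).choose (s + 1) =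
      unimodalCount b (i + 1) s + unimodalCount b i (s + 1) := by
  rw [boundedPathCount_succ_mul_choose_eq_sum,
    min_eq_right (Nat.succ_le_succ (hb i.le_succ))]
  rfl

theorem alternating_sum_boundedPathCount (b : ℕ → ℕ) (hb : Monotone b) (m t : ℕ) :
    ∑ i ∈ Finset.range (m + 1), (-1 : ℤ) ^ i * boundedPathCount b i (b i + 1) *
        (b i + 1).choose (m + t + 1 - i) = (-1) ^ m * unimodalCount b m t := by
  induction m generalizing t with
  | zero => simp [← boundedPathCount_zero_mul_choose]
  | succ m ih =>
    have h := boundedPathCount_succ_mul_choose b hb m t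
    zify at h
    have h' := ih (t + 1)
    rw [Finset.sum_range_succ, show m + 1 + t + 1 - (m + 1) = t + 1 by omega, mul_assoc, h,
      show m + 1 + t + 1 = m + (t + 1) + 1 by omega, h']
    ring

theorem hBinom_natCast_sub_add_one (x i j : ℕ) :
    hBinom x ((j : ℤ) - i + 1) = if i ≤ j + 1 then (x.choose (j + 1 - i) : ℤ) else 0 := by
  rw [hBinom]
  split_ifs with h₁ h₂ h₂
  · rw [show ((j : ℤ) - i + 1).toNat = j + 1 - i by omega, Int.toNat_natCast]
  · omega
  · rw [Nat.choose_eq_zero_of_lt (by omega), Nat.cast_zero]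
  · rfl

/-- The matrix with entries `C(b i + 1, j - i + 1)`. -/
def binomMatrix (b : ℕ → ℕ) (n : ℕ) : Matrix (Fin n) (Fin n) ℤ :=
  Matrix.of fun i j => if (i : ℕ) ≤ j + 1 then ((b i + 1).choose (j + 1 - i) : ℤ) else 0

theorem sum_smul_binomMatrix (b : ℕ → ℕ) (hb : Monotone b) (m : ℕ) (j : Fin (m + 1)) :
    ∑ i : Fin (m + 1), ((-1 : ℤ) ^ (i : ℕ) * boundedPathCount b i (b i + 1)) *
        binomMatrix b (m + 1) i j =
      if j = Fin.last m then (-1) ^ m * (boundedPathCount b (m + 1) (b m + 1) : ℤ) else 0 := by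
  have key := alternating_sum_boundedPathCount b hb j 0
  rw [unimodalCount_zero_right, add_zero] at key
  have hfull : ∀ i ∈ Finset.range (j + 1),
      (-1 : ℤ) ^ i * boundedPathCount b i (b i + 1) *
        (if i ≤ (j : ℕ) + 1 then ((b i + 1).choose (j + 1 - i) : ℤ) else 0) =
      (-1 : ℤ) ^ i * boundedPathCount b i (b i + 1) * (b i + 1).choose (j + 1 - i) := by
    intro i hi
    rw [if_pos (Finset.mem_range.1 hi).le]
  simp only [binomMatrix, Matrix.of_apply]
  rw [Fin.sum_univ_eq_sum_range (fun i => (-1 : ℤ) ^ i * boundedPathCount b i (b i + 1) *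
    (if i ≤ (j : ℕ) + 1 then ((b i + 1).choose (j + 1 - i) : ℤ) else 0)) (m + 1)]
  split_ifs with hj
  · subst hj
    rw [Fin.val_last] at key hfull ⊢
    rw [Finset.sum_congr rfl hfull, key]
  · have hjm : (j : ℕ) < m := Fin.val_lt_last hj
    rw [← Finset.sum_subset (Finset.range_mono (show (j : ℕ) + 2 ≤ m + 1 by omega)),
      Finset.sum_range_succ, Finset.sum_congr rfl hfull, key, if_pos le_rfl,
      boundedPathCount_succ_of_lt b (Nat.lt_succ_of_le (hb (j : ℕ).le_succ))]
    · simp only [Nat.sub_self, Nat.choose_zero_right]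
      push_cast
      ring
    · intro i _ hi
      rw [if_neg (by rw [Finset.mem_range] at hi; omega), mul_zero]

theorem det_binomMatrix_submatrix (b : ℕ → ℕ) (m : ℕ) :
    ((binomMatrix b (m + 1)).submatrix Fin.succ Fin.castSucc).det = 1 := by
  rw [Matrix.det_of_isUpperTriangular]
  · simp [binomMatrix]
  · intro i j (hij : j < i)
    simp only [Matrix.submatrix_apply, binomMatrix, Matrix.of_apply, Fin.val_succ,
      Fin.val_castSucc]
    exact if_neg (by have : (j : ℕ) < i := hij; omega)

theorem det_binomMatrix (b : ℕ → ℕ) (hb : Monotone b) (m : ℕ) :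
    (binomMatrix b (m + 1)).det = boundedPathCount b (m + 1) (b m + 1) := by
  have h := Matrix.det_updateRow_sum (binomMatrix b (m + 1)) 0
    fun i => (-1 : ℤ) ^ (i : ℕ) * boundedPathCount b i (b i + 1)
  have hrow : ∑ i : Fin (m + 1), ((-1 : ℤ) ^ (i : ℕ) * boundedPathCount b i (b i + 1)) •
      binomMatrix b (m + 1) i = Pi.single (Fin.last m)
        ((-1) ^ m * (boundedPathCount b (m + 1) (b m + 1) : ℤ)) := by
    ext j
    simpa [Finset.sum_apply, Pi.single_apply] using sum_smul_binomMatrix b hb m j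
  rw [hrow, Matrix.det_succ_row_zero, Finset.sum_eq_single (Fin.last m)] at h
  · rw [Fin.succAbove_last, ← Fin.succAbove_zero, Matrix.submatrix_updateRow_succAbove,
      Fin.succAbove_zero, det_binomMatrix_submatrix] at h
    simp only [Matrix.updateRow_self, Pi.single_eq_same, Fin.val_last, Fin.val_zero, pow_zero,
      boundedPathCount, one_mul, mul_one, smul_eq_mul, Nat.cast_one, ← mul_assoc, ← mul_pow,
      neg_mul_neg, one_pow] at h ⊢
    exact h.symm
  · intro j _ hj
    simp [hj]
  · simp

/-- The number of weakly increasing sequences of naturals `(y_1, …, y_n)` with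
`y_i ≤ k (i - 1)` (encoding `k`-Fuss–Catalan paths of length `n`) equals the
determinant of the matrix with entries `C(k (i - 1) + 1, j - i + 1)`. -/
theorem fussCatalan_paths_eq_det (k n : ℕ) (hk : 0 < k) (hn : 0 < n) :
    (Nat.card {y : Fin n → ℕ // Monotone y ∧ ∀ i, y i ≤ k * (i : ℕ)} : ℤ) =
      (Matrix.of fun i j : Fin n =>
        hBinom ((k * (i : ℕ) : ℕ) + 1) (((j : ℕ) : ℤ) - ((i : ℕ) : ℤ) + 1)).det := by
  obtain ⟨m, rfl⟩ := Nat.exists_eq_succ_of_ne_zero hn.ne'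
  have hb : Monotone (k * ·) := fun _ _ h => Nat.mul_le_mul_left k h
  rw [card_monotone_le (k * ·) hb,
    boundedPathCount_succ_of_lt _ (Nat.lt_succ_of_le (hb m.le_succ)), ← det_binomMatrix _ hb]
  congr 1
  ext i j
  exact (hBinom_natCast_sub_add_one (k * i + 1) i j).symm
end

section
/- Let k and n be positive integers. The number of weakly increasing sequences of natural numbers (y_1,…,y_n) with y_i ≤ k(i−1) for all i = 1,…,n equals the k-Fuss–Catalan number F_n = (1/(kn+1))·C((k+1)n, n). -/
/-- Weakly increasing sequences of naturals `(y_0, …, y_{n-1})` with `y_i < r + k i`. -/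
abbrev BoundedMonotone (k n r : ℕ) : Type :=
  {y : Fin n → ℕ // Monotone y ∧ ∀ i, y i < r + k * (i : ℕ)}

namespace BoundedMonotone

instance instFinite (k n r : ℕ) : Finite (BoundedMonotone k n r) :=
  ((Set.finite_Iic fun i : Fin n => r + k * (i : ℕ)).subset
    fun _ hy i => (hy.2 i).le).to_subtype

/-- Add one to every entry. -/
def shift {k n r : ℕ} (y : BoundedMonotone k n r) : BoundedMonotone k n (r + 1) :=
  ⟨fun i => y.1 i + 1, fun _ _ h => Nat.succ_le_succ (y.2.1 h), fun i => by
    have := y.2.2 i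
    lia⟩

/-- Prepend a zero. -/
def consZero {k n r : ℕ} (z : BoundedMonotone k n (r + 1 + k)) :
    BoundedMonotone k (n + 1) (r + 1) :=
  ⟨Fin.cons 0 z.1, by
    intro i j h
    cases i using Fin.cases with
    | zero => simp
    | succ i =>
      cases j using Fin.cases with
      | zero => simp at h
      | succ j => simpa using z.2.1 (Fin.succ_le_succ_iff.mp h), by
    intro i
    cases i using Fin.cases with
    | zero => simp
    | succ i =>
      have := z.2.2 i
      simp only [Fin.cons_succ, Fin.val_succ]
      linarith⟩

theorem bijective_elim_shift_consZero (k n r : ℕ) :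
    Function.Bijective (Sum.elim (shift : BoundedMonotone k (n + 1) r → _)
      (consZero : BoundedMonotone k n (r + 1 + k) → _)) := by
  constructor
  · refine Function.Injective.sumElim ?_ ?_ ?_
    · intro y z h
      ext i
      have := congrFun (congrArg Subtype.val h) i
      simpa [shift] using this
    · intro y z h
      ext i
      have := congrFun (congrArg Subtype.val h) i.succ
      simpa [consZero] using this
    · intro y z h
      have := congrFun (congrArg Subtype.val h) 0
      simp [shift, consZero] at this
  · rintro ⟨y, hm, hb⟩
    by_cases h0 : y 0 = 0
    · refine ⟨Sum.inr ⟨fun i => y i.succ, fun _ _ h => hm (Fin.succ_le_succ_iff.mpr h),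
        fun i => ?_⟩, ?_⟩
      · have := hb i.succ
        simp only [Fin.val_succ] at this
        linarith
      · ext i
        cases i using Fin.cases with
        | zero => simp [consZero, h0]
        | succ i => simp [consZero]
    · have hpos : ∀ i, 1 ≤ y i := fun i =>
        (Nat.one_le_iff_ne_zero.mpr h0).trans (hm (Fin.zero_le i))
      refine ⟨Sum.inl ⟨fun i => y i - 1, fun _ _ h => Nat.sub_le_sub_right (hm h) 1,
        fun i => ?_⟩, ?_⟩
      · have := hb i
        have := hpos i
        lia
      · ext i
        exact Nat.sub_add_cancel (hpos i)

theorem card_succ_succ (k n r : ℕ) :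
    Nat.card (BoundedMonotone k (n + 1) (r + 1)) =
      Nat.card (BoundedMonotone k (n + 1) r) + Nat.card (BoundedMonotone k n (r + 1 + k)) := by
  rw [← Nat.card_sum]
  exact (Nat.card_eq_of_bijective _ (bijective_elim_shift_consZero k n r)).symm

theorem card_zero (k r : ℕ) : Nat.card (BoundedMonotone k 0 r) = 1 := by
  have : Unique (BoundedMonotone k 0 r) :=
    { default := ⟨Fin.elim0, fun i => i.elim0, fun i => i.elim0⟩
      uniq := fun _ => Subtype.ext (Subsingleton.elim _ _) }
  exact Nat.card_unique

theorem card_succ_zero (k n : ℕ) : Nat.card (BoundedMonotone k (n + 1) 0) = 0 := by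
  have : IsEmpty (BoundedMonotone k (n + 1) 0) := ⟨fun y => by simpa using y.2.2 0⟩
  exact Nat.card_of_isEmpty

theorem mul_card (k n r : ℕ) :
    (r + (k + 1) * n) * Nat.card (BoundedMonotone k n r) =
      r * (r + (k + 1) * n).choose n := by
  induction n generalizing r with
  | zero => rw [card_zero]; simp
  | succ n ihn =>
    induction r with
    | zero => simp [card_succ_zero]
    | succ r ihr =>
      have hb := ihn (r + 1 + k)
      rw [card_succ_succ]
      generalize Nat.card (BoundedMonotone k (n + 1) r) = a at *
      generalize Nat.card (BoundedMonotone k n (r + 1 + k)) = b at *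
      obtain ⟨m, hm⟩ : ∃ m, m = r + (k + 1) * (n + 1) := ⟨_, rfl⟩
      rw [← hm] at ihr
      rw [show r + 1 + k + (k + 1) * n = m by rw [hm]; ring] at hb
      rw [show r + 1 + (k + 1) * (n + 1) = m + 1 by rw [hm]; ring, Nat.choose_succ_succ]
      have hnm : n ≤ m := by rw [hm]; nlinarith
      have hXY := Nat.choose_succ_right_eq m n
      have hm0 : (m : ℤ) ≠ 0 := by
        have : 0 < m := by rw [hm]; positivity
        exact_mod_cast this.ne'
      simp only [Nat.succ_eq_add_one]
      zify [hnm] at *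
      apply mul_left_cancel₀ hm0
      generalize (m.choose n : ℤ) = X at *
      generalize (m.choose (n + 1) : ℤ) = Y at *
      linear_combination (m + 1 : ℤ) * ihr + (m + 1 : ℤ) * hb - (k + 1 : ℤ) * hXY -
        (Y + X) * hm

end BoundedMonotone

/-- The number of weakly increasing sequences of naturals `(y_1, …, y_n)` with
`y_i ≤ k (i - 1)` (encoding `k`-Fuss–Catalan paths of length `n`) equals the
`k`-Fuss–Catalan number `F_n = (1 / (k n + 1)) * C((k+1) n, n)`. -/
theorem fussCatalan_paths_card (k n : ℕ) (hk : 0 < k) (hn : 0 < n) :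
    ((Nat.card {y : Fin n → ℕ // Monotone y ∧ ∀ i, y i ≤ k * (i : ℕ)} : ℕ) : ℚ) =
      ((((k + 1) * n).choose n : ℚ)) / ((k * n : ℕ) + 1) := by
  have hcard : Nat.card {y : Fin n → ℕ // Monotone y ∧ ∀ i, y i ≤ k * (i : ℕ)} =
      Nat.card (BoundedMonotone k n 1) := by
    simp only [BoundedMonotone, Nat.lt_one_add_iff]
  have h := BoundedMonotone.mul_card k n 1
  have hc := Nat.choose_mul_succ_eq ((k + 1) * n) n
  rw [show (k + 1) * n + 1 - n = k * n + 1 by rw [add_mul, one_mul]; lia] at hc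
  rw [one_mul, add_comm 1] at h
  rw [← h] at hc
  rw [hcard, eq_div_iff (by positivity)]
  have hpos : 0 < (k + 1) * n + 1 := Nat.succ_pos _
  have key : Nat.card (BoundedMonotone k n 1) * (k * n + 1) = ((k + 1) * n).choose n := by
    apply Nat.eq_of_mul_eq_mul_left hpos
    rw [← mul_assoc, ← hc, mul_comm]
  exact_mod_cast key
end

section
/- For every positive integer n, the n-th ternary number T_n = (1/(2n+1))·C(3n, n) equals the determinant of the n×n matrix whose (i,j) entry is the binomial coefficient C(2i − 1, j − i + 1) for 1 ≤ i, j ≤ n. -/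
/-- The `n`-th finite difference of a polynomial of degree less than `n` vanishes. -/
theorem alternating_sum_choose_mul_eval_eq_zero (P : Polynomial ℚ) {n : ℕ}
    (hP : P.natDegree < n) :
    ∑ k ∈ Finset.range (n + 1), (-1 : ℚ) ^ k * n.choose k * P.eval (k : ℚ) = 0 := by
  have h := congrFun (Polynomial.fwdDiff_iter_eq_zero_of_degree_lt hP) 0
  rw [fwdDiff_iter_eq_sum_shift] at h
  have h2 : ∑ k ∈ Finset.range (n + 1), (-1 : ℚ) ^ k * n.choose k * P.eval (k : ℚ) =
      (-1) ^ n * ∑ k ∈ Finset.range (n + 1),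
        ((-1 : ℤ) ^ (n - k) * n.choose k) • P.eval (0 + k • (1 : ℚ)) := by
    rw [Finset.mul_sum]
    refine Finset.sum_congr rfl fun k hk => ?_
    obtain ⟨d, rfl⟩ := Nat.exists_eq_add_of_le (Nat.lt_succ_iff.mp (Finset.mem_range.mp hk))
    have hd : (-1 : ℚ) ^ d * (-1) ^ d = 1 := by rw [← mul_pow]; norm_num
    simp only [zsmul_eq_mul, nsmul_eq_mul, zero_add, mul_one, Nat.add_sub_cancel_left]
    push_cast
    rw [pow_add]
    linear_combination (-(-1 : ℚ) ^ k * ((k + d).choose k) * P.eval (k : ℚ)) * hd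
  rw [h2, h]
  simp

/-- A product of binomial coefficients occurring in the ternary recurrence, written through
a falling factorial. -/
theorem choose_mul_ternary {m k : ℕ} (hk : k ≤ m + 1) :
    ((2 * k + 1).choose (m + 1 - k) : ℚ) * ((3 * k).choose k / (2 * k + 1)) =
      (m + 1).choose k * (3 * k).descFactorial m / (m + 1).factorial := by
  rcases lt_or_ge (3 * k) m with hlt | hge
  · rw [Nat.choose_eq_zero_of_lt (by omega), Nat.descFactorial_of_lt hlt]
    simp
  · have h1 := Nat.choose_mul_factorial_mul_factorial (show m + 1 - k ≤ 2 * k + 1 by omega)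
    have h2 := Nat.choose_mul_factorial_mul_factorial (show k ≤ 3 * k by omega)
    have h3 := Nat.choose_mul_factorial_mul_factorial hk
    have h4 := Nat.factorial_mul_descFactorial hge
    rw [show 2 * k + 1 - (m + 1 - k) = 3 * k - m by omega, Nat.factorial_succ (2 * k)] at h1
    rw [show 3 * k - k = 2 * k by omega] at h2
    have e1 := Nat.factorial_pos (m + 1 - k)
    have e2 := Nat.factorial_pos (3 * k - m)
    have e3 := Nat.factorial_pos k
    have e4 := Nat.factorial_pos (2 * k)
    qify at h1 h2 h3 h4 e1 e2 e3 e4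
    rw [← eq_div_iff (by positivity), ← eq_div_iff (by positivity)] at h1 h2 h3
    rw [mul_comm, ← eq_div_iff (by positivity)] at h4
    rw [h1, h2, h3, h4]
    field_simp

/-- The recurrence satisfied by the ternary numbers. -/
theorem alternating_sum_choose_mul_ternary (m : ℕ) :
    ∑ k ∈ Finset.range (m + 2), (-1 : ℚ) ^ k *
      (((2 * k + 1).choose (m + 1 - k) : ℚ) * ((3 * k).choose k / (2 * k + 1))) = 0 := by
  have hdeg : ((descPochhammer ℚ m).comp (3 * Polynomial.X)).natDegree < m + 1 := by
    refine Nat.lt_succ_of_le (Polynomial.natDegree_comp_le.trans ?_)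
    rw [descPochhammer_natDegree]
    calc m * (3 * Polynomial.X : Polynomial ℚ).natDegree ≤ m * 1 :=
          Nat.mul_le_mul_left _ (by compute_degree)
      _ = m := mul_one m
  have h := alternating_sum_choose_mul_eval_eq_zero _ hdeg
  rw [← zero_div ((m + 1).factorial : ℚ), ← h, Finset.sum_div]
  refine Finset.sum_congr rfl fun k hk => ?_
  rw [choose_mul_ternary (Nat.lt_succ_iff.mp (Finset.mem_range.mp hk)),
    ← descPochhammer_eval_eq_descFactorial]
  simp only [Polynomial.eval_comp, Polynomial.eval_mul, Polynomial.eval_ofNat, Polynomial.eval_X]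
  push_cast
  ring

/-- A normalized upper Hessenberg determinant is determined by its cofactor recurrence. -/
theorem det_hessenberg_eq (H : ℕ → ℕ → ℚ) (T : ℕ → ℚ) (hsub : ∀ j, H (j + 1) j = 1)
    (hlow : ∀ i j, j + 1 < i → H i j = 0) (hT : T 0 = 1)
    (hrec : ∀ j, ∑ k ∈ Finset.range (j + 2), (-1) ^ k * (H k j * T k) = 0) (m : ℕ) :
    (Matrix.of fun i j : Fin (m + 1) => H i j).det = T (m + 1) := by
  set A : Matrix (Fin (m + 1)) (Fin (m + 1)) ℚ := Matrix.of fun i j => H i j with hA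
  let c : Fin (m + 1) → ℚ := fun k => (-1) ^ (k : ℕ) * T k
  have hrow (j : Fin (m + 1)) : (∑ k, c k • A k) j =
      ∑ k ∈ Finset.range (m + 1), (-1) ^ k * (H k j * T k) := by
    rw [Finset.sum_apply, Finset.sum_range]
    refine Finset.sum_congr rfl fun k _ => ?_
    simp only [c, hA, Pi.smul_apply, Matrix.of_apply, smul_eq_mul]
    ring
  have hrow_castSucc (j : Fin m) : (∑ k, c k • A k) j.castSucc = 0 := by
    rw [hrow, ← hrec j, Fin.val_castSucc]
    refine (Finset.sum_subset (Finset.range_subset_range.mpr (by omega)) fun k _ hk => ?_).symm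
    rw [Finset.mem_range, not_lt] at hk
    rw [hlow k j (by omega)]
    ring
  have hrow_last : (∑ k, c k • A k) (Fin.last m) = (-1) ^ m * T (m + 1) := by
    have h := hrec m
    rw [Finset.sum_range_succ, hsub] at h
    rw [hrow, Fin.val_last]
    linear_combination h
  have hdet := Matrix.det_updateRow_sum A 0 c
  have hminor : ((A.updateRow 0 (∑ k, c k • A k)).submatrix Fin.succ
      (Fin.last m).succAbove).det = 1 := by
    rw [Matrix.det_of_isUpperTriangular]
    · simp [hA, hsub]
    · intro i j hij
      have : (j : ℕ) < i := hij
      simpa [hA] using hlow (i + 1) j (by omega)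
  rw [Matrix.det_succ_row_zero, Fin.sum_univ_castSucc] at hdet
  simp only [Matrix.updateRow_self, hrow_castSucc, hrow_last, hminor] at hdet
  have hs : (-1 : ℚ) ^ m * (-1) ^ m = 1 := by rw [← mul_pow]; norm_num
  simp only [c, Fin.val_zero, hT, Fin.val_last, mul_zero, zero_mul, Finset.sum_const_zero,
    smul_eq_mul, pow_zero] at hdet
  linear_combination -hdet + T (m + 1) * hs

/-- The entries of the ternary matrix as natural-number binomial coefficients. -/
theorem hBinom_hessenberg (i j : ℕ) :
    hBinom (2 * i + 1) ((j : ℤ) - i + 1) =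
      if i ≤ j + 1 then ((2 * i + 1).choose (j + 1 - i) : ℤ) else 0 := by
  unfold hBinom
  rw [show (2 * (i : ℤ) + 1).toNat = 2 * i + 1 by omega,
    show ((j : ℤ) - i + 1).toNat = j + 1 - i by omega]
  split_ifs
  · rfl
  · omega
  · rw [Nat.choose_eq_zero_of_lt (by omega), Nat.cast_zero]
  · rfl

/-- The `n`-th ternary number `T_n = (1 / (2n + 1)) * C(3n, n)` equals the determinant
of the `n × n` matrix with `(i, j)` entry `C(2i - 1, j - i + 1)` (so, with the 0-based
index `i`, the entry is `C(2i + 1, j - i + 1)`). -/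
theorem ternary_eq_det (n : ℕ) (hn : 0 < n) :
    ((Nat.choose (3 * n) n : ℚ)) / (2 * (n : ℚ) + 1) =
      ((Matrix.of fun i j : Fin n =>
        ((hBinom (2 * (i : ℕ) + 1) (((j : ℕ) : ℤ) - ((i : ℕ) : ℤ) + 1) : ℤ) : ℚ)).det) := by
  obtain ⟨m, rfl⟩ := Nat.exists_eq_add_of_lt hn
  rw [zero_add]
  refine (det_hessenberg_eq (fun i j => (hBinom (2 * i + 1) ((j : ℤ) - i + 1) : ℚ))
    (fun k => ((3 * k).choose k : ℚ) / (2 * k + 1)) (fun j => ?_) (fun i j hij => ?_)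
    (by simp) (fun j => ?_) m).symm
  · rw [hBinom_hessenberg]
    simp
  · simp [hBinom_hessenberg, not_le.mpr hij]
  · rw [← alternating_sum_choose_mul_ternary j]
    refine Finset.sum_congr rfl fun k hk => ?_
    rw [hBinom_hessenberg, if_pos (Nat.lt_succ_iff.mp (Finset.mem_range.mp hk)), Int.cast_natCast]
end

section
/- Let m, r be coprime positive integers and n a positive integer, and for i = 1,…,mn set a_i = r·⌊(i−1)/m⌋ + ⌊(r/m)·(i − m·⌊(i−1)/m⌋ − 1)⌋. Then the number of weakly increasing sequences of natural numbers (y_1,…,y_{mn}) with y_i ≤ a_i for all i equals the determinant of the mn×mn matrix whose (i,j) entry is C(a_i + 1, j − i + 1). -/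
/-- Pascal's rule for `hBinom`. -/
theorem hBinom_add_one {x : ℤ} (hx : 0 ≤ x) (t : ℤ) :
    hBinom (x + 1) t = hBinom x t + hBinom x (t - 1) := by
  have hBinom_natCast (p q : ℕ) : hBinom p q = p.choose q := by
    unfold hBinom
    split_ifs with h
    · simp
    · rw [Nat.choose_eq_zero_of_lt (by omega), Nat.cast_zero]
  have hBinom_of_neg {y u : ℤ} (hu : u < 0) : hBinom y u = 0 :=
    if_neg fun h => by omega
  lift x to ℕ using hx
  rcases lt_or_ge t 0 with ht | ht
  · rw [hBinom_of_neg ht, hBinom_of_neg ht, hBinom_of_neg (by omega), add_zero]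
  · lift t to ℕ using ht
    rw [← Nat.cast_succ, hBinom_natCast, hBinom_natCast]
    cases t with
    | zero => rw [hBinom_of_neg (by simp)]; simp
    | succ t =>
      rw [Nat.cast_succ, add_sub_cancel_right, hBinom_natCast, Nat.choose_succ_succ]
      push_cast
      ring

/-- The weakly increasing sequences with all terms at least `s` and bounded above by `a`. -/
def boundedMonotone {k : ℕ} (a : Fin k → ℕ) (s : ℕ) : Set (Fin k → ℕ) :=
  {y | Monotone y ∧ ∀ i, s ≤ y i ∧ y i ≤ a i}

theorem boundedMonotone_finite {k : ℕ} (a : Fin k → ℕ) (s : ℕ) :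
    (boundedMonotone a s).Finite :=
  (Set.finite_Iic a).subset fun _ hy i => (hy.2 i).2

/-- Splitting according to whether the first term equals the lower bound `s`. -/
theorem boundedMonotone_eq_union {k : ℕ} {a : Fin (k + 1) → ℕ} {s : ℕ} (hs : s ≤ a 0) :
    boundedMonotone a s =
      boundedMonotone a (s + 1) ∪ Fin.cons s '' boundedMonotone (Fin.tail a) s := by
  ext y
  constructor
  · rintro ⟨hy, hb⟩
    by_cases h : y 0 = s
    · refine Or.inr ⟨Fin.tail y, ⟨fun i j hij => hy (Fin.succ_le_succ_iff.2 hij),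
        fun i => hb i.succ⟩, ?_⟩
      rw [← h, Fin.cons_self_tail]
    · refine Or.inl ⟨hy, fun i => ⟨?_, (hb i).2⟩⟩
      have h0 := (hb 0).1
      have hi := hy (Fin.zero_le i)
      omega
  · rintro (⟨hy, hb⟩ | ⟨y, ⟨hy, hb⟩, rfl⟩)
    · exact ⟨hy, fun i => ⟨(Nat.le_succ s).trans (hb i).1, (hb i).2⟩⟩
    · refine ⟨fun i j hij => ?_, fun i => ?_⟩
      · induction i using Fin.cases with
        | zero =>
          induction j using Fin.cases with
          | zero => exact le_rfl
          | succ j => simpa using (hb j).1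
        | succ i =>
          induction j using Fin.cases with
          | zero => exact absurd hij (by simp)
          | succ j => simpa using hy (Fin.succ_le_succ_iff.1 hij)
      · induction i using Fin.cases with
        | zero => simpa using hs
        | succ i => simpa [Fin.tail] using hb i

theorem ncard_boundedMonotone_succ {k : ℕ} {a : Fin (k + 1) → ℕ} {s : ℕ} (hs : s ≤ a 0) :
    (boundedMonotone a s).ncard =
      (boundedMonotone a (s + 1)).ncard + (boundedMonotone (Fin.tail a) s).ncard := by
  rw [boundedMonotone_eq_union hs, Set.ncard_union_eq _ (boundedMonotone_finite _ _)
    ((boundedMonotone_finite _ _).image _),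
    Set.ncard_image_of_injective _ (Fin.cons_right_injective (α := fun _ => ℕ) s)]
  rw [Set.disjoint_left]
  rintro _ ⟨-, hb⟩ ⟨y, -, rfl⟩
  simpa using (hb 0).1

/-- The matrix with entries `C(a_i + 1 - s, j - i + 1)`. -/
def stepMatrix {k : ℕ} (a : Fin k → ℕ) (s : ℕ) : Matrix (Fin k) (Fin k) ℤ :=
  Matrix.of fun i j => hBinom ((a i : ℤ) + 1 - s) (((j : ℕ) : ℤ) - ((i : ℕ) : ℤ) + 1)

theorem stepMatrix_submatrix_succ {k : ℕ} (a : Fin (k + 1) → ℕ) (s : ℕ) :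
    (stepMatrix a s).submatrix Fin.succ Fin.succ = stepMatrix (Fin.tail a) s := by
  ext i j
  simp [stepMatrix, Fin.tail]

theorem stepMatrix_apply_eq_add {k : ℕ} {a : Fin k → ℕ} {s : ℕ} {i : Fin k} (hs : s ≤ a i)
    (j : Fin k) :
    stepMatrix a s i j = stepMatrix a (s + 1) i j +
      hBinom ((a i : ℤ) - s) (((j : ℕ) : ℤ) - ((i : ℕ) : ℤ)) := by
  have h := hBinom_add_one (x := (a i : ℤ) - s) (by omega) (((j : ℕ) : ℤ) - ((i : ℕ) : ℤ) + 1)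
  simp only [stepMatrix, Matrix.of_apply]
  rw [add_sub_right_comm, h, add_sub_cancel_right]
  congr 2
  push_cast
  ring

theorem det_stepMatrix_succ {k : ℕ} {a : Fin (k + 1) → ℕ} {s : ℕ} (hs : ∀ i, s ≤ a i) :
    (stepMatrix a s).det = (stepMatrix a (s + 1)).det + (stepMatrix (Fin.tail a) s).det := by
  let N : Matrix (Fin (k + 1)) (Fin (k + 1)) ℤ := Matrix.of fun i =>
    Fin.cons (stepMatrix a (s + 1) i 0) fun j => stepMatrix a s i j.succ
  have hN : (stepMatrix a (s + 1)).det = N.det := by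
    refine Matrix.det_eq_of_forall_col_eq_smul_add_pred (fun _ => -1) (fun _ => rfl) fun i j => ?_
    have h : N i j.succ = stepMatrix a s i j.succ := rfl
    rw [h, stepMatrix_apply_eq_add (hs i)]
    have h' : stepMatrix a (s + 1) i j.castSucc =
        hBinom ((a i : ℤ) - s) (((j.succ : ℕ) : ℤ) - ((i : ℕ) : ℤ)) := by
      simp only [stepMatrix, Matrix.of_apply, Fin.val_castSucc, Fin.val_succ]
      congr 1 <;> push_cast <;> ring
    rw [h']
    ring
  have hminor (i : Fin (k + 1)) :
      N.submatrix i.succAbove Fin.succ = (stepMatrix a s).submatrix i.succAbove Fin.succ := rfl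
  have hcol (i : Fin (k + 1)) : stepMatrix a s i 0 = N i 0 + if i = 0 then 1 else 0 := by
    rw [stepMatrix_apply_eq_add (hs i)]
    congr 1
    split_ifs with h
    · subst h
      simp [hBinom, hs 0]
    · refine if_neg fun h' => h (Fin.ext ?_)
      simp only [Fin.val_zero] at h' ⊢
      omega
  rw [hN, Matrix.det_succ_column_zero, Matrix.det_succ_column_zero N,
    ← stepMatrix_submatrix_succ]
  simp only [hminor, hcol, mul_add, add_mul, Finset.sum_add_distrib]
  simp

/-- The number of weakly increasing sequences between a constant `s` and a weakly increasing
sequence `a` is `det C(a_i + 1 - s, j - i + 1)`. -/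
theorem ncard_boundedMonotone_eq_det (k : ℕ) (a : Fin k → ℕ) (ha : Monotone a) (s : ℕ)
    (hs : ∀ i, s ≤ a i + 1) : ((boundedMonotone a s).ncard : ℤ) = (stepMatrix a s).det := by
  induction k generalizing s with
  | zero =>
    have h : boundedMonotone a s = {a} := by
      ext y
      simp [boundedMonotone, Subsingleton.elim y a, ha]
    simp [h]
  | succ k ih =>
    induction hd : a 0 + 1 - s generalizing s with
    | zero =>
      have hs0 : s = a 0 + 1 := by have := hs 0; omega
      have h : boundedMonotone a s = ∅ := by
        ext y
        simp only [boundedMonotone, Set.mem_ofPred_eq, Set.mem_empty_iff_false, iff_false]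
        rintro ⟨-, hb⟩
        have := hb 0
        omega
      rw [h, Matrix.det_eq_zero_of_row_eq_zero 0]
      · simp
      · intro j
        refine if_neg fun h' => ?_
        simp only [Fin.val_zero] at h'
        omega
    | succ d ihd =>
      have hsa (i) : s ≤ a i := by have := ha (Fin.zero_le i); omega
      rw [ncard_boundedMonotone_succ (hsa 0), det_stepMatrix_succ hsa, Nat.cast_add,
        ihd (s + 1) (fun i => Nat.succ_le_succ (hsa i)) (by omega),
        ih (Fin.tail a) (fun i j hij => ha (Fin.succ_le_succ_iff.2 hij)) s
          fun i => (hsa i.succ).trans (Nat.le_succ _)]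

/-- For coprime positive integers `m, r` and positive `n`, with (0-based index)
`a_i = r * ⌊i / m⌋ + ⌊r * (i - m * ⌊i / m⌋) / m⌋`, the number of weakly increasing
sequences of naturals `(y_1, …, y_{mn})` with `y_i ≤ a_i` (encoding lattice paths
from `(0,0)` to `(mn, rn)` weakly below `y = (r/m) x`) equals the determinant of the
`mn × mn` matrix with entries `C(a_i + 1, j - i + 1)`. -/
theorem genFussCatalan_paths_eq_det (m r n : ℕ) (hm : 0 < m) (hr : 0 < r)
    (hmr : Nat.Coprime m r) (hn : 0 < n) (a : Fin (m * n) → ℕ)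
    (ha : ∀ i : Fin (m * n),
      a i = r * ((i : ℕ) / m) + r * ((i : ℕ) - m * ((i : ℕ) / m)) / m) :
    (Nat.card {y : Fin (m * n) → ℕ // Monotone y ∧ ∀ i, y i ≤ a i} : ℤ) =
      (Matrix.of fun i j : Fin (m * n) =>
        hBinom ((a i : ℤ) + 1) (((j : ℕ) : ℤ) - ((i : ℕ) : ℤ) + 1)).det := by
  have ha' : ∀ i, a i = r * (i : ℕ) / m := fun i => by
    have h : r * (i : ℕ) = r * ((i : ℕ) % m) + m * (r * ((i : ℕ) / m)) := by
      conv_lhs => rw [← Nat.mod_add_div (i : ℕ) m]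
      ring
    rw [ha, h, Nat.add_mul_div_left _ _ hm, ← Nat.mod_eq_sub_mul_div, add_comm]
  have hmono : Monotone a := fun i j hij => by
    rw [ha', ha']
    exact Nat.div_le_div_right (Nat.mul_le_mul_left r hij)
  have h := ncard_boundedMonotone_eq_det (m * n) a hmono 0 fun _ => Nat.zero_le _
  simp only [boundedMonotone, stepMatrix, Nat.zero_le, true_and, Nat.cast_zero, sub_zero] at h
  exact h
end
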